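/- Let G be a finite connected simple graph with vertices u₁, …, u_n, and let G̃ be obtained from G by adding a new vertex u_{n+1} joined to u_n by a single edge. Then Λ₁(G̃) ≥ Λ₁(G) (as elements of [0, ∞]). -/

import Mathlib

open Finset Filter Topology
open scoped Classical ENNReal

noncomputable section

variable {V : Type*} [Fintype V]

/-- The set of neighbors of `u` as a `Finset`. -/
def nbr (G : SimpleGraph V) (u : V) : Finset V :=
  Finset.univ.filter (fun v => G.Adj u v)

/-- The vertex-weight `m₀(u) = ∑_{v ∼ u} l(uv)` induced by the edge-length function `l`. -/
def m0 (G : SimpleGraph V) (l : V → V → ℝ) (u : V) : ℝ :=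
  ∑ v ∈ nbr G u, l u v

/-- The Fujiwara Laplacian `(Δ_l φ)(u) = ∑_{v ∼ u} (m₁(uv)/m₀(u)) (φ(u) − φ(v))`,
where `m₁(uv) = 1/l(uv)`. -/
def lap (G : SimpleGraph V) (l : V → V → ℝ) (φ : V → ℝ) (u : V) : ℝ :=
  ∑ v ∈ nbr G u, ((1 / l u v) / m0 G l u) * (φ u - φ v)

/-- `l` is an edge-length function: symmetric and positive on adjacent pairs. -/
def IsLength (G : SimpleGraph V) (l : V → V → ℝ) : Prop :=
  (∀ u v, l u v = l v u) ∧ ∀ u v, G.Adj u v → 0 < l u v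

/-- The Dirichlet energy `∑_{uv ∈ E} m₁(uv) (φ(u) − φ(v))²`
(each edge counted once, via half the sum over ordered adjacent pairs). -/
def energy (G : SimpleGraph V) (l : V → V → ℝ) (φ : V → ℝ) : ℝ :=
  (1/2) * ∑ u, ∑ v ∈ nbr G u, (1 / l u v) * (φ u - φ v) ^ 2

/-- The squared norm `∑_{u ∈ V} m₀(u) φ(u)²`. -/
def mass (G : SimpleGraph V) (l : V → V → ℝ) (φ : V → ℝ) : ℝ :=
  ∑ u, m0 G l u * φ u ^ 2

/-- The first nonzero eigenvalue of the Fujiwara Laplacian, via its variational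
characterization as the infimum of the Rayleigh quotient over nonzero functions
orthogonal to the constants. -/
def lambda1 (G : SimpleGraph V) (l : V → V → ℝ) : ℝ :=
  sInf { r | ∃ φ : V → ℝ, φ ≠ 0 ∧ (∑ u, m0 G l u * φ u) = 0 ∧
    r = energy G l φ / mass G l φ }

/-- The largest eigenvalue of the Fujiwara Laplacian, via its variational
characterization as the supremum of the Rayleigh quotient. -/
def lambdaMax (G : SimpleGraph V) (l : V → V → ℝ) : ℝ :=
  sSup { r | ∃ φ : V → ℝ, φ ≠ 0 ∧ r = energy G l φ / mass G l φ }

/-- `Λ₁(G)`: the supremum, in `[0, ∞]`, of `λ₁(G, l)` over all edge-length functions `l`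
normalized by `∑_{u ∈ V} m₀(u) = 1`. -/
def Lambda1 (G : SimpleGraph V) : ℝ≥0∞ :=
  ⨆ (l : V → V → ℝ) (_ : IsLength G l ∧ (∑ u, m0 G l u) = 1),
    ENNReal.ofReal (lambda1 G l)

/-- `μ` is the nondecreasing sequence of eigenvalues (with multiplicity) of the
Fujiwara Laplacian `Δ_l`: it is monotone and admits a corresponding family of
eigenfunctions that is orthonormal for the inner product `⟨φ, ψ⟩ = ∑ m₀(u) φ(u) ψ(u)`. -/
def IsLapEigSeq (G : SimpleGraph V) (l : V → V → ℝ)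
    (μ : Fin (Fintype.card V) → ℝ) : Prop :=
  Monotone μ ∧ ∃ φ : Fin (Fintype.card V) → V → ℝ,
    (∀ i u, lap G l (φ i) u = μ i * φ i u) ∧
    (∀ i j, (∑ u, m0 G l u * φ i u * φ j u) = if i = j then 1 else 0)


/-- The graph `G̃` obtained from `G` by adding a new pendant vertex (`none`) joined
to the vertex `x` by a single edge; the old vertices are embedded via `some`. -/
def addLeaf (G : SimpleGraph V) (x : V) : SimpleGraph (Option V) :=
  SimpleGraph.fromRel (fun a b =>
    (∃ u v, a = some u ∧ b = some v ∧ G.Adj u v) ∨ (a = some x ∧ b = none))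

lemma sum_nbr_eq_sum_ite {W : Type*} [Fintype W] (H : SimpleGraph W) (u : W) (f : W → ℝ) :
    ∑ v ∈ nbr H u, f v = ∑ v, if H.Adj u v then f v else 0 := by
  rw [nbr, Finset.sum_filter]

lemma addLeaf_adj_some_some {W : Type*} (G : SimpleGraph W) (x u v : W) :
    (addLeaf G x).Adj (some u) (some v) ↔ G.Adj u v := by
  simp only [addLeaf, SimpleGraph.fromRel_adj]
  constructor
  · rintro ⟨-, (⟨a, b, ha, hb, h⟩ | ⟨-, h⟩) | (⟨a, b, ha, hb, h⟩ | ⟨-, h⟩)⟩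
    · cases ha; cases hb; exact h
    · cases h
    · cases ha; cases hb; exact h.symm
    · cases h
  · intro h
    exact ⟨fun e => h.ne (Option.some.inj e), Or.inl (Or.inl ⟨u, v, rfl, rfl, h⟩)⟩

lemma addLeaf_adj_some_none {W : Type*} (G : SimpleGraph W) (x u : W) :
    (addLeaf G x).Adj (some u) none ↔ u = x := by
  simp [addLeaf]

lemma addLeaf_adj_none_some {W : Type*} (G : SimpleGraph W) (x u : W) :
    (addLeaf G x).Adj none (some u) ↔ u = x := by
  rw [SimpleGraph.adj_comm, addLeaf_adj_some_none]

lemma sum_nbr_addLeaf_some (G : SimpleGraph V) (x u : V) (f : Option V → ℝ) :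
    ∑ v ∈ nbr (addLeaf G x) (some u), f v =
      (if u = x then f none else 0) + ∑ v ∈ nbr G u, f (some v) := by
  simp only [sum_nbr_eq_sum_ite, Fintype.sum_option, addLeaf_adj_some_none,
    addLeaf_adj_some_some]

lemma sum_nbr_addLeaf_none (G : SimpleGraph V) (x : V) (f : Option V → ℝ) :
    ∑ v ∈ nbr (addLeaf G x) none, f v = f (some x) := by
  simp [sum_nbr_eq_sum_ite, Fintype.sum_option, addLeaf_adj_none_some]

/-- The edge-length function on `addLeaf G x` that scales `l` by `c` on the old edges and
gives the pendant edge length `ε`. -/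
def leafLength (l : V → V → ℝ) (c ε : ℝ) : Option V → Option V → ℝ
  | some u, some v => c * l u v
  | _, _ => ε

lemma m0_leafLength_some (G : SimpleGraph V) (x : V) (l : V → V → ℝ) (c ε : ℝ) (u : V) :
    m0 (addLeaf G x) (leafLength l c ε) (some u) =
      (if u = x then ε else 0) + c * m0 G l u := by
  simp [m0, sum_nbr_addLeaf_some, leafLength, Finset.mul_sum]

lemma m0_leafLength_none (G : SimpleGraph V) (x : V) (l : V → V → ℝ) (c ε : ℝ) :
    m0 (addLeaf G x) (leafLength l c ε) none = ε := by
  rw [m0, sum_nbr_addLeaf_none, leafLength]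
  simp

lemma isLength_leafLength {W : Type*} {G : SimpleGraph W} (x : W) {l : W → W → ℝ}
    (hl : IsLength G l) {c ε : ℝ} (hc : 0 < c) (hε : 0 < ε) :
    IsLength (addLeaf G x) (leafLength l c ε) := by
  constructor
  · rintro (_ | u) (_ | v) <;> simp [leafLength, hl.1]
  · rintro (_ | u) (_ | v) h
    · exact hε
    · exact hε
    · exact hε
    · exact mul_pos hc (hl.2 _ _ ((addLeaf_adj_some_some G x u v).1 h))

lemma sum_m0_leafLength (G : SimpleGraph V) (x : V) (l : V → V → ℝ) (c ε : ℝ) :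
    ∑ u, m0 (addLeaf G x) (leafLength l c ε) u = 2 * ε + c * ∑ u, m0 G l u := by
  simp only [Fintype.sum_option, m0_leafLength_some, m0_leafLength_none,
    Finset.sum_add_distrib, Finset.sum_ite_eq', Finset.mem_univ, if_true, Finset.mul_sum]
  ring

lemma energy_leafLength (G : SimpleGraph V) (x : V) (l : V → V → ℝ) (c ε : ℝ)
    (φ : Option V → ℝ) :
    energy (addLeaf G x) (leafLength l c ε) φ =
      energy G l (fun u => φ (some u)) / c + (φ none - φ (some x)) ^ 2 / ε := by
  have h : ∀ u v : V, 1 / (c * l u v) * (φ (some u) - φ (some v)) ^ 2 =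
      c⁻¹ * (1 / l u v * (φ (some u) - φ (some v)) ^ 2) := fun u v => by
    rw [one_div, mul_inv]; ring
  simp only [energy, Fintype.sum_option, sum_nbr_addLeaf_none, sum_nbr_addLeaf_some,
    leafLength, h, ← Finset.mul_sum, Finset.sum_add_distrib, Finset.sum_ite_eq',
    Finset.mem_univ, if_true]
  ring

lemma mass_leafLength (G : SimpleGraph V) (x : V) (l : V → V → ℝ) (c ε : ℝ)
    (φ : Option V → ℝ) :
    mass (addLeaf G x) (leafLength l c ε) φ =
      c * mass G l (fun u => φ (some u)) + ε * φ (some x) ^ 2 + ε * φ none ^ 2 := by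
  simp only [mass, Fintype.sum_option, m0_leafLength_none, m0_leafLength_some, add_mul,
    ite_mul, zero_mul, Finset.sum_add_distrib, Finset.sum_ite_eq', Finset.mem_univ, if_true,
    mul_assoc, ← Finset.mul_sum]
  ring

lemma energy_nonneg {G : SimpleGraph V} {l : V → V → ℝ} (hl : IsLength G l) (φ : V → ℝ) :
    0 ≤ energy G l φ := by
  refine mul_nonneg (by norm_num) (Finset.sum_nonneg fun u _ => Finset.sum_nonneg fun v hv => ?_)
  have := hl.2 u v (by simpa [nbr] using hv)
  positivity

lemma energy_sub_const (G : SimpleGraph V) (l : V → V → ℝ) (φ : V → ℝ) (a : ℝ) :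
    energy G l (fun u => φ u - a) = energy G l φ := by
  simp [energy]

lemma mass_pos {G : SimpleGraph V} {l : V → V → ℝ} (hm : ∀ u, 0 < m0 G l u) {φ : V → ℝ}
    (hφ : φ ≠ 0) : 0 < mass G l φ := by
  obtain ⟨u, hu⟩ := Function.ne_iff.1 hφ
  refine Finset.sum_pos' (fun v _ => mul_nonneg (hm v).le (sq_nonneg _)) ⟨u, mem_univ u, ?_⟩
  exact mul_pos (hm u) (sq_pos_of_ne_zero hu)

lemma m0_mul_sq_le_mass {G : SimpleGraph V} {l : V → V → ℝ} (hm : ∀ u, 0 < m0 G l u)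
    (φ : V → ℝ) (u : V) : m0 G l u * φ u ^ 2 ≤ mass G l φ :=
  Finset.single_le_sum (f := fun v => m0 G l v * φ v ^ 2)
    (fun v _ => mul_nonneg (hm v).le (sq_nonneg _)) (mem_univ u)

/-- Among the translates of `φ` by constants, the mean-zero one has the least mass. -/
lemma mass_le_mass_sub_const {G : SimpleGraph V} {l : V → V → ℝ} (hm : ∀ u, 0 < m0 G l u)
    {φ : V → ℝ} (hφ : ∑ u, m0 G l u * φ u = 0) (a : ℝ) :
    mass G l φ ≤ mass G l (fun u => φ u - a) := by
  have h : mass G l (fun u => φ u - a) =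
      mass G l φ - 2 * a * ∑ u, m0 G l u * φ u + a ^ 2 * ∑ u, m0 G l u := by
    simp only [mass, Finset.mul_sum, ← Finset.sum_sub_distrib, ← Finset.sum_add_distrib]
    exact Finset.sum_congr rfl fun u _ => by ring
  rw [h, hφ]
  have := Finset.sum_nonneg fun u (_ : u ∈ univ) => (hm u).le
  nlinarith [mul_nonneg (sq_nonneg a) this]

lemma lambda1_mul_mass_le_energy {G : SimpleGraph V} {l : V → V → ℝ} (hl : IsLength G l)
    (hm : ∀ u, 0 < m0 G l u) {φ : V → ℝ} (hφ : ∑ u, m0 G l u * φ u = 0) :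
    lambda1 G l * mass G l φ ≤ energy G l φ := by
  by_cases h0 : φ = 0
  · subst h0; simp [mass, energy]
  rw [← le_div_iff₀ (mass_pos hm h0)]
  refine csInf_le ⟨0, ?_⟩ ⟨φ, h0, hφ, rfl⟩
  rintro _ ⟨ψ, -, -, rfl⟩
  exact div_nonneg (energy_nonneg hl ψ)
    (Finset.sum_nonneg fun u _ => mul_nonneg (hm u).le (sq_nonneg _))

lemma le_lambda1 {G : SimpleGraph V} {l : V → V → ℝ} [Nontrivial V]
    (hm : ∀ u, 0 < m0 G l u) {t : ℝ}
    (h : ∀ φ : V → ℝ, ∑ u, m0 G l u * φ u = 0 → t * mass G l φ ≤ energy G l φ) :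
    t ≤ lambda1 G l := by
  refine le_csInf ?_ ?_
  · obtain ⟨a, b, hab⟩ := exists_pair_ne V
    refine ⟨_, Pi.single a (m0 G l b) - Pi.single b (m0 G l a), fun h0 => ?_, ?_, rfl⟩
    · have := congrFun h0 a
      simp [hab] at this
      exact (hm b).ne' this
    · simp [mul_sub, Pi.single_apply, mul_comm]
  · rintro _ ⟨φ, h0, hφ, rfl⟩
    exact (le_div_iff₀ (mass_pos hm h0)).2 (h φ hφ)

lemma m0_pos {G : SimpleGraph V} [Nontrivial V] (hconn : G.Connected) {l : V → V → ℝ}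
    (hl : IsLength G l) (u : V) : 0 < m0 G l u := by
  obtain ⟨v, hv⟩ := hconn.preconnected.exists_adj_of_nontrivial u
  exact Finset.sum_pos (fun w hw => hl.2 u w (by simpa [nbr] using hw))
    ⟨v, by simpa [nbr] using hv⟩

/-- A Rayleigh quotient bound for `addLeaf G x` when the pendant edge is short. -/
lemma mul_mass_leafLength_le_energy {G : SimpleGraph V} {l : V → V → ℝ} (x : V)
    (hl : IsLength G l) (hm : ∀ u, 0 < m0 G l u) (hsum : ∑ u, m0 G l u = 1) {c ε t : ℝ}
    (hc : 0 < c) (hc1 : c ≤ 1) (hε : 0 < ε) (ht : 0 ≤ t)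
    (htε : t * (1 + 3 * ε / m0 G l x) ≤ lambda1 G l) (htε' : t * (2 * ε ^ 2) ≤ 1)
    (hm' : ∀ u, 0 < m0 (addLeaf G x) (leafLength l c ε) u)
    {φ : Option V → ℝ} (hφ : ∑ u, m0 (addLeaf G x) (leafLength l c ε) u * φ u = 0) :
    t * mass (addLeaf G x) (leafLength l c ε) φ ≤
      energy (addLeaf G x) (leafLength l c ε) φ := by
  set a : ℝ := ∑ u, m0 G l u * φ (some u) with ha
  set ψ : V → ℝ := fun u => φ (some u) - a with hψ
  have hψ0 : ∑ u, m0 G l u * ψ u = 0 := by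
    simp only [hψ, mul_sub, Finset.sum_sub_distrib, ← Finset.sum_mul, hsum]
    rw [← ha]; ring
  set d : ℝ := φ none - φ (some x) with hd
  have hmass : mass (addLeaf G x) (leafLength l c ε) φ ≤
      c * mass G l ψ + ε * ψ x ^ 2 + ε * (ψ x + d) ^ 2 := by
    refine (mass_le_mass_sub_const hm' hφ a).trans_eq ?_
    rw [mass_leafLength]
    simp only [hψ, hd]; ring
  have hE : energy (addLeaf G x) (leafLength l c ε) φ = energy G l ψ / c + d ^ 2 / ε := by
    rw [energy_leafLength, energy_sub_const]
  have hx : ψ x ^ 2 ≤ mass G l ψ / m0 G l x := by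
    rw [le_div_iff₀ (hm x), mul_comm]
    exact m0_mul_sq_le_mass hm ψ x
  have hM : 0 ≤ mass G l ψ :=
    Finset.sum_nonneg fun u _ => mul_nonneg (hm u).le (sq_nonneg _)
  have hEc : energy G l ψ ≤ energy G l ψ / c :=
    le_div_self (energy_nonneg hl ψ) hc hc1
  have hbound : mass (addLeaf G x) (leafLength l c ε) φ ≤
      (1 + 3 * ε / m0 G l x) * mass G l ψ + 2 * ε * d ^ 2 := by
    have h1 : c * mass G l ψ ≤ mass G l ψ := mul_le_of_le_one_left hM hc1
    have h2 : ε * (ψ x + d) ^ 2 ≤ ε * (2 * ψ x ^ 2 + 2 * d ^ 2) :=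
      mul_le_mul_of_nonneg_left (by nlinarith [sq_nonneg (ψ x - d)]) hε.le
    have h3 : 3 * ε * ψ x ^ 2 ≤ 3 * ε * (mass G l ψ / m0 G l x) :=
      mul_le_mul_of_nonneg_left hx (by positivity)
    have h4 : (1 + 3 * ε / m0 G l x) * mass G l ψ =
      mass G l ψ + 3 * ε * (mass G l ψ / m0 G l x) := by ring
    linarith
  have hd2 : t * (2 * ε * d ^ 2) ≤ d ^ 2 / ε := by
    rw [le_div_iff₀ hε]
    nlinarith [mul_le_mul_of_nonneg_right htε' (sq_nonneg d)]
  calc t * mass (addLeaf G x) (leafLength l c ε) φ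
      ≤ t * ((1 + 3 * ε / m0 G l x) * mass G l ψ + 2 * ε * d ^ 2) :=
        mul_le_mul_of_nonneg_left hbound ht
    _ = t * (1 + 3 * ε / m0 G l x) * mass G l ψ + t * (2 * ε * d ^ 2) := by ring
    _ ≤ lambda1 G l * mass G l ψ + d ^ 2 / ε :=
        add_le_add (mul_le_mul_of_nonneg_right htε hM) hd2
    _ ≤ energy G l ψ / c + d ^ 2 / ε :=
        add_le_add_left ((lambda1_mul_mass_le_energy hl hm hψ0).trans hEc) _
    _ = _ := hE.symm

/-- If `G̃` is obtained from the finite connected simple graph `G` by adding a new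
pendant vertex joined to the vertex `x` by a single edge, then `Λ₁(G̃) ≥ Λ₁(G)`
(as elements of `[0, ∞]`). -/
theorem Lambda1_le_addLeaf {V : Type*} [Fintype V]
    (G : SimpleGraph V) (hconn : G.Connected) (x : V) :
    Lambda1 G ≤ Lambda1 (addLeaf G x) := by
  refine iSup₂_le fun l ⟨hl, hsum⟩ => ?_
  have : Nontrivial V := by
    by_contra h
    rw [not_nontrivial_iff_subsingleton] at h
    have h0 : ∀ u, m0 G l u = 0 := fun u =>
      Finset.sum_eq_zero fun v hv =>
        absurd (Subsingleton.elim u v) (SimpleGraph.Adj.ne (by simpa [nbr] using hv : G.Adj u v))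
    simp [h0] at hsum
  have hm := m0_pos hconn hl
  refine le_of_forall_lt fun s hs => ?_
  obtain ⟨r, hsr, hr⟩ := exists_between hs
  refine hsr.trans_le ?_
  lift r to NNReal using hr.ne_top
  have ht : (r : ℝ) < lambda1 G l := by
    simpa using (ENNReal.lt_ofReal_iff_toReal_lt ENNReal.coe_ne_top).1 hr
  have hlim : ∀ᶠ ε in 𝓝[>] (0 : ℝ), (r : ℝ) * (1 + 3 * ε / m0 G l x) < lambda1 G l ∧
      (r : ℝ) * (2 * ε ^ 2) < 1 ∧ 2 * ε < 1 := by
    refine Eventually.filter_mono nhdsWithin_le_nhds (.and ?_ (.and ?_ ?_)) <;>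
      refine ContinuousAt.eventually_lt (by fun_prop) (by fun_prop) ?_ <;> simp [ht]
  obtain ⟨ε, ⟨h1, h2, h3⟩, hε⟩ := (hlim.and self_mem_nhdsWithin).exists
  have hε : 0 < ε := hε
  have hc : 0 < 1 - 2 * ε := by linarith
  have hm' : ∀ u, 0 < m0 (addLeaf G x) (leafLength l (1 - 2 * ε) ε) u := by
    rintro (_ | u)
    · rwa [m0_leafLength_none]
    · rw [m0_leafLength_some]
      have := mul_pos hc (hm u)
      split_ifs <;> linarith
  refine le_iSup₂_of_le (leafLength l (1 - 2 * ε) ε)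
    ⟨isLength_leafLength x hl hc hε, by rw [sum_m0_leafLength, hsum]; ring⟩ ?_
  rw [← ENNReal.ofReal_coe_nnreal]
  exact ENNReal.ofReal_le_ofReal (le_lambda1 hm' fun φ hφ =>
    mul_mass_leafLength_le_energy x hl hm hsum hc (by linarith) hε r.2 h1.le h2.le hm' hφ)

end
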